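/- Let A be the Archimedean path, so A(t) is the law of (𝒜(0), 𝒜(t)) with 𝒜 the Archimedean process. For all 0 ≤ s < t ≤ 1, the 2-Wasserstein distance satisfies W₂(A(s), A(t)) = √(8/3)·sin(π(t − s)/4). -/

import Mathlib

open MeasureTheory Set Filter
open scoped ENNReal Real Topology

/-- Optimal transportation cost between two measures for the cost `c`. -/
noncomputable def W2sqCost {K : Type*} [MeasurableSpace K] (c : K × K → ℝ)
    (μ ν : Measure K) : ℝ :=
  sInf {e | ∃ m : Measure (K × K), IsProbabilityMeasure m ∧
    m.map Prod.fst = μ ∧ m.map Prod.snd = ν ∧ e = ∫ p, c p ∂m}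

/-- The squared 2-Wasserstein distance between measures on the plane,
with the Euclidean metric: `W₂(μ,ν)² = inf over couplings of E[‖V-W‖²]`. -/
noncomputable def W2sqE (μ ν : Measure (ℝ × ℝ)) : ℝ :=
  W2sqCost (fun p => (p.1.1 - p.2.1) ^ 2 + (p.1.2 - p.2.2) ^ 2) μ ν

/-- The Archimedean measure, with density (2π√(1-x²-y²))⁻¹ on the unit disk. -/
noncomputable def archMeasure : Measure (ℝ × ℝ) :=
  volume.withDensity fun p =>
    ENNReal.ofReal
      (if p.1 ^ 2 + p.2 ^ 2 < 1 then (2 * π * Real.sqrt (1 - p.1 ^ 2 - p.2 ^ 2))⁻¹ else 0)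

/-- The Archimedean path: `archPath t` is the law of (𝒜(0), 𝒜(t)) where
𝒜(t) = cos(πt)·Aₓ + sin(πt)·A_y with (Aₓ, A_y) distributed as the Archimedean measure. -/
noncomputable def archPath (t : ℝ) : Measure (ℝ × ℝ) :=
  archMeasure.map fun p => (p.1, Real.cos (π * t) * p.1 + Real.sin (π * t) * p.2)

/-- The density of the Archimedean measure with respect to the Lebesgue measure. -/
noncomputable def archDensity (p : ℝ × ℝ) : ℝ :=
  if p.1 ^ 2 + p.2 ^ 2 < 1 then (2 * π * Real.sqrt (1 - p.1 ^ 2 - p.2 ^ 2))⁻¹ else 0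

lemma measurable_archDensity : Measurable archDensity := by
  unfold archDensity
  refine Measurable.ite (measurableSet_lt (by fun_prop) (by fun_prop)) (by fun_prop) (by fun_prop)

lemma archDensity_nonneg (p : ℝ × ℝ) : 0 ≤ archDensity p := by
  unfold archDensity
  split_ifs <;> positivity

/-- Rotation of the plane by the angle `θ`. -/
noncomputable def planeRotation (θ : ℝ) : ℝ × ℝ →ₗ[ℝ] ℝ × ℝ :=
  Matrix.toLin (Module.Basis.finTwoProd ℝ) (Module.Basis.finTwoProd ℝ)
    !![Real.cos θ, -Real.sin θ; Real.sin θ, Real.cos θ]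

lemma planeRotation_apply (θ : ℝ) (p : ℝ × ℝ) :
    planeRotation θ p =
      (Real.cos θ * p.1 - Real.sin θ * p.2, Real.sin θ * p.1 + Real.cos θ * p.2) := by
  rcases p with ⟨x, y⟩
  rw [planeRotation, Matrix.toLin_finTwoProd_apply]
  simp [sub_eq_add_neg]

lemma measurePreserving_planeRotation (θ : ℝ) :
    MeasurePreserving (planeRotation θ) (volume : Measure (ℝ × ℝ)) volume := by
  have hdet : LinearMap.det (planeRotation θ) = 1 := by
    rw [planeRotation, LinearMap.det_toLin, Matrix.det_fin_two_of]
    nlinarith [Real.sin_sq_add_cos_sq θ]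
  refine ⟨(planeRotation θ).continuous_of_finiteDimensional.measurable, ?_⟩
  rw [Measure.map_linearMap_addHaar_eq_smul_addHaar _ (by rw [hdet]; exact one_ne_zero), hdet]
  simp

lemma archDensity_planeRotation (θ : ℝ) (p : ℝ × ℝ) :
    archDensity (planeRotation θ p) = archDensity p := by
  have h : (planeRotation θ p).1 ^ 2 + (planeRotation θ p).2 ^ 2 = p.1 ^ 2 + p.2 ^ 2 := by
    rw [planeRotation_apply]
    linear_combination (p.1 ^ 2 + p.2 ^ 2) * Real.sin_sq_add_cos_sq θ
  simp only [archDensity, sub_sub, h]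

lemma archMeasure_eq : archMeasure =
    volume.withDensity fun p => ENNReal.ofReal (archDensity p) := rfl

lemma measurePreserving_planeRotation_archMeasure (θ : ℝ) :
    MeasurePreserving (planeRotation θ) archMeasure archMeasure := by
  have hR := measurePreserving_planeRotation θ
  refine ⟨hR.measurable, ?_⟩
  ext S hS
  rw [Measure.map_apply hR.measurable hS, archMeasure_eq, withDensity_apply _ hS,
    withDensity_apply _ (hR.measurable hS),
    ← hR.setLIntegral_comp_preimage hS measurable_archDensity.ennreal_ofReal]
  simp only [archDensity_planeRotation]

lemma archDensity_polarCoord_symm {p : ℝ × ℝ} (hp : 0 < p.1) :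
    archDensity (polarCoord.symm p) =
      if p.1 < 1 then (2 * π * Real.sqrt (1 - p.1 ^ 2))⁻¹ else 0 := by
  have h : (polarCoord.symm p).1 ^ 2 + (polarCoord.symm p).2 ^ 2 = p.1 ^ 2 := by
    simp only [polarCoord_symm_apply]
    linear_combination p.1 ^ 2 * Real.sin_sq_add_cos_sq p.2
  simp only [archDensity, sub_sub, h, sq_lt_one_iff₀ hp.le]

/-- Integrals of radial functions against the Archimedean density. -/
lemma integral_archDensity_mul_radial (g : ℝ → ℝ) :
    ∫ p : ℝ × ℝ, archDensity p * g (p.1 ^ 2 + p.2 ^ 2) =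
      ∫ r in (0 : ℝ)..1, r * g (r ^ 2) / Real.sqrt (1 - r ^ 2) := by
  rw [← integral_comp_polarCoord_symm]
  have hcongr : ∀ p ∈ polarCoord.target,
      p.1 • (archDensity (polarCoord.symm p) *
        g ((polarCoord.symm p).1 ^ 2 + (polarCoord.symm p).2 ^ 2)) =
      (Iio (1 : ℝ)).indicator (fun r => r * g (r ^ 2) / Real.sqrt (1 - r ^ 2)) p.1 *
        (2 * π)⁻¹ := by
    intro p hp
    have hp0 : 0 < p.1 := hp.1
    have h : (polarCoord.symm p).1 ^ 2 + (polarCoord.symm p).2 ^ 2 = p.1 ^ 2 := by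
      simp only [polarCoord_symm_apply]
      linear_combination p.1 ^ 2 * Real.sin_sq_add_cos_sq p.2
    rw [archDensity_polarCoord_symm hp0, h, indicator_apply]
    simp only [mem_Iio, smul_eq_mul]
    split_ifs with h1
    · rw [mul_inv]; ring
    · simp
  rw [setIntegral_congr_fun polarCoord.open_target.measurableSet hcongr, polarCoord_target,
    Measure.volume_eq_prod,
    setIntegral_prod_mul (fun r => (Iio (1 : ℝ)).indicator
      (fun r => r * g (r ^ 2) / Real.sqrt (1 - r ^ 2)) r) (fun _ => (2 * π)⁻¹),
    setIntegral_indicator measurableSet_Iio, Ioi_inter_Iio, ← integral_Ioc_eq_integral_Ioo,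
    ← intervalIntegral.integral_of_le zero_le_one]
  simp [Real.volume_real_Ioo_of_le (by linarith [Real.pi_pos] : -π ≤ π)]
  field_simp
  ring_nf

lemma integral_zero_one_of_hasDerivAt_of_nonneg {F f : ℝ → ℝ}
    (hF : ContinuousOn F (Icc 0 1)) (hderiv : ∀ r ∈ Ioo (0 : ℝ) 1, HasDerivAt F (f r) r)
    (hf : ∀ r ∈ Ioo (0 : ℝ) 1, 0 ≤ f r) : ∫ r in (0 : ℝ)..1, f r = F 1 - F 0 :=
  intervalIntegral.integral_eq_sub_of_hasDerivAt_of_le zero_le_one hF hderiv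
    ((intervalIntegrable_iff_integrableOn_Ioc_of_le zero_le_one).2
      (intervalIntegral.integrableOn_deriv_of_nonneg hF hderiv hf))

lemma hasDerivAt_sqrt_one_sub_sq {r : ℝ} (hr : r ∈ Ioo (0 : ℝ) 1) :
    HasDerivAt (fun r => Real.sqrt (1 - r ^ 2)) (-(r / Real.sqrt (1 - r ^ 2))) r := by
  have hpos : 0 < 1 - r ^ 2 := by nlinarith [hr.1, hr.2]
  convert ((hasDerivAt_pow 2 r).const_sub 1).sqrt hpos.ne' using 1
  simp
  ring

lemma integral_archDensity : ∫ p, archDensity p = 1 := by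
  have h := integral_archDensity_mul_radial (fun _ => 1)
  simp only [mul_one] at h
  rw [h, integral_zero_one_of_hasDerivAt_of_nonneg (F := fun r => -Real.sqrt (1 - r ^ 2))
    (by fun_prop) (fun r hr => (hasDerivAt_sqrt_one_sub_sq hr).neg.congr_deriv (by simp))
    (fun r hr => div_nonneg hr.1.le (Real.sqrt_nonneg _))]
  simp

lemma integral_archDensity_mul_normSq :
    ∫ p, archDensity p * (p.1 ^ 2 + p.2 ^ 2) = 2 / 3 := by
  have h := integral_archDensity_mul_radial id
  simp only [id] at h
  rw [h, integral_zero_one_of_hasDerivAt_of_nonneg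
    (F := fun r => Real.sqrt (1 - r ^ 2) ^ 3 / 3 - Real.sqrt (1 - r ^ 2))
    (by fun_prop) (fun r hr => ?_)
    (fun r hr => div_nonneg (mul_nonneg hr.1.le (sq_nonneg r)) (Real.sqrt_nonneg _))]
  · norm_num
  · have hpos : 0 < 1 - r ^ 2 := by nlinarith [hr.1, hr.2]
    have hd := hasDerivAt_sqrt_one_sub_sq hr
    refine (((hd.pow 3).div_const 3).sub hd).congr_deriv ?_
    have hs : Real.sqrt (1 - r ^ 2) ≠ 0 := (Real.sqrt_pos.2 hpos).ne'
    field_simp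
    rw [Real.sq_sqrt hpos.le]
    ring

lemma integral_archMeasure (f : ℝ × ℝ → ℝ) :
    ∫ p, f p ∂archMeasure = ∫ p, archDensity p * f p := by
  rw [archMeasure_eq, integral_withDensity_eq_integral_toReal_smul
    measurable_archDensity.ennreal_ofReal (by simp)]
  simp [ENNReal.toReal_ofReal, archDensity_nonneg]

instance isProbabilityMeasure_archMeasure : IsProbabilityMeasure archMeasure := by
  constructor
  have hint : Integrable archDensity :=
    .of_integral_ne_zero (by rw [integral_archDensity]; exact one_ne_zero)
  rw [archMeasure_eq, withDensity_apply _ .univ, Measure.restrict_univ,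
    ← ofReal_integral_eq_lintegral_ofReal hint (.of_forall archDensity_nonneg),
    integral_archDensity, ENNReal.ofReal_one]

lemma integral_normSq_archMeasure : ∫ p, (p.1 ^ 2 + p.2 ^ 2) ∂archMeasure = 2 / 3 := by
  rw [integral_archMeasure, integral_archDensity_mul_normSq]

lemma integrable_normSq_archMeasure :
    Integrable (fun p : ℝ × ℝ => p.1 ^ 2 + p.2 ^ 2) archMeasure :=
  .of_integral_ne_zero (by rw [integral_normSq_archMeasure]; norm_num)

lemma memLp_fst_archMeasure : MemLp (fun p : ℝ × ℝ => p.1) 2 archMeasure := by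
  rw [memLp_two_iff_integrable_sq (by fun_prop)]
  refine integrable_normSq_archMeasure.mono' (by fun_prop) (.of_forall fun p => ?_)
  rw [Real.norm_of_nonneg (sq_nonneg _)]
  linarith [sq_nonneg p.2]

lemma memLp_snd_archMeasure : MemLp (fun p : ℝ × ℝ => p.2) 2 archMeasure := by
  rw [memLp_two_iff_integrable_sq (by fun_prop)]
  refine integrable_normSq_archMeasure.mono' (by fun_prop) (.of_forall fun p => ?_)
  rw [Real.norm_of_nonneg (sq_nonneg _)]
  linarith [sq_nonneg p.1]

lemma integral_fst_sq_eq_integral_snd_sq_archMeasure :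
    ∫ p, p.1 ^ 2 ∂archMeasure = ∫ p, p.2 ^ 2 ∂archMeasure := by
  have hR := measurePreserving_planeRotation_archMeasure (π / 2)
  conv_lhs => rw [← hR.map_eq]
  rw [integral_map hR.measurable.aemeasurable (by fun_prop)]
  simp [planeRotation_apply]

lemma integral_fst_sq_archMeasure : ∫ p, p.1 ^ 2 ∂archMeasure = 1 / 3 := by
  have h := integral_normSq_archMeasure
  rw [integral_add memLp_fst_archMeasure.integrable_sq memLp_snd_archMeasure.integrable_sq,
    ← integral_fst_sq_eq_integral_snd_sq_archMeasure] at h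
  linarith

lemma integral_snd_sq_archMeasure : ∫ p, p.2 ^ 2 ∂archMeasure = 1 / 3 := by
  rw [← integral_fst_sq_eq_integral_snd_sq_archMeasure, integral_fst_sq_archMeasure]

/-- The map sending the Archimedean measure to `archPath t`, adapted to the principal axes of
`archPath t`. -/
noncomputable def archMap (t : ℝ) (p : ℝ × ℝ) : ℝ × ℝ :=
  (Real.cos (π * t / 2) * p.1 - Real.sin (π * t / 2) * p.2,
    Real.cos (π * t / 2) * p.1 + Real.sin (π * t / 2) * p.2)

lemma measurable_archMap (t : ℝ) : Measurable (archMap t) := by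
  unfold archMap
  fun_prop

lemma map_archMap_archMeasure (t : ℝ) : archMeasure.map (archMap t) = archPath t := by
  have hR := measurePreserving_planeRotation_archMeasure (π * t / 2)
  rw [archPath]
  conv_rhs => rw [← hR.map_eq]
  rw [Measure.map_map (by fun_prop) hR.measurable]
  congr 1
  funext p
  have h : π * t = 2 * (π * t / 2) := by ring
  simp only [Function.comp, planeRotation_apply, archMap, Prod.mk.injEq, true_and]
  rw [h, Real.cos_two_mul, Real.sin_two_mul, ← h]
  linear_combination (-2 * Real.cos (π * t / 2) * p.1) * Real.sin_sq_add_cos_sq (π * t / 2)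

lemma memLp_sum_archPath (t : ℝ) : MemLp (fun v : ℝ × ℝ => v.1 + v.2) 2 (archPath t) := by
  rw [← map_archMap_archMeasure,
    memLp_map_measure_iff (by fun_prop) (measurable_archMap t).aemeasurable]
  refine (memLp_fst_archMeasure.const_mul (2 * Real.cos (π * t / 2))).ae_eq
    (.of_forall fun p => ?_)
  simp only [archMap, Function.comp]
  ring

lemma memLp_diff_archPath (t : ℝ) : MemLp (fun v : ℝ × ℝ => v.2 - v.1) 2 (archPath t) := by
  rw [← map_archMap_archMeasure,
    memLp_map_measure_iff (by fun_prop) (measurable_archMap t).aemeasurable]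
  refine (memLp_snd_archMeasure.const_mul (2 * Real.sin (π * t / 2))).ae_eq
    (.of_forall fun p => ?_)
  simp only [archMap, Function.comp]
  ring

lemma integral_sum_sq_archPath (t : ℝ) :
    ∫ v, (v.1 + v.2) ^ 2 ∂archPath t = 4 / 3 * Real.cos (π * t / 2) ^ 2 := by
  rw [← map_archMap_archMeasure,
    integral_map (measurable_archMap t).aemeasurable (by fun_prop)]
  have h (p : ℝ × ℝ) : ((archMap t p).1 + (archMap t p).2) ^ 2 =
      4 * Real.cos (π * t / 2) ^ 2 * p.1 ^ 2 := by
    simp only [archMap]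
    ring
  simp only [h, integral_const_mul, integral_fst_sq_archMeasure]
  ring

lemma integral_diff_sq_archPath (t : ℝ) :
    ∫ v, (v.2 - v.1) ^ 2 ∂archPath t = 4 / 3 * Real.sin (π * t / 2) ^ 2 := by
  rw [← map_archMap_archMeasure,
    integral_map (measurable_archMap t).aemeasurable (by fun_prop)]
  have h (p : ℝ × ℝ) : ((archMap t p).2 - (archMap t p).1) ^ 2 =
      4 * Real.sin (π * t / 2) ^ 2 * p.2 ^ 2 := by
    simp only [archMap]
    ring
  simp only [h, integral_const_mul, integral_snd_sq_archMeasure]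
  ring

/-- The reverse triangle inequality in `L²`, in terms of integrals of squares. -/
lemma mul_sq_sub_le_integral_sub_sq {Ω : Type*} [MeasurableSpace Ω] {m : Measure Ω}
    {f g : Ω → ℝ} (hf : MemLp f 2 m) (hg : MemLp g 2 m) {k a b : ℝ} (hk : 0 ≤ k)
    (ha : 0 ≤ a) (hb : 0 ≤ b) (hfa : ∫ ω, f ω ^ 2 ∂m = k * a ^ 2)
    (hgb : ∫ ω, g ω ^ 2 ∂m = k * b ^ 2) :
    k * (a - b) ^ 2 ≤ ∫ ω, (f ω - g ω) ^ 2 ∂m := by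
  have hfg : Integrable (fun ω => f ω * g ω) m := hf.integrable_mul hg
  have key (x y : ℝ) : ∫ ω, (x * f ω - y * g ω) ^ 2 ∂m =
      x ^ 2 * (k * a ^ 2) + y ^ 2 * (k * b ^ 2) - 2 * x * y * ∫ ω, f ω * g ω ∂m := by
    have h (ω : Ω) : (x * f ω - y * g ω) ^ 2 =
        x ^ 2 * f ω ^ 2 + y ^ 2 * g ω ^ 2 - 2 * x * y * (f ω * g ω) := by ring
    have hf2 := hf.integrable_sq.const_mul (x ^ 2)
    have hg2 := hg.integrable_sq.const_mul (y ^ 2)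
    simp only [h]
    rw [integral_sub (by exact hf2.add hg2) (hfg.const_mul _), integral_add hf2 hg2]
    simp only [integral_const_mul, hfa, hgb]
  have hdiscrim := discrim_le_zero (a := k * a ^ 2) (b := -2 * ∫ ω, f ω * g ω ∂m)
    (c := k * b ^ 2) fun x => by
      have h := key x 1
      have h0 : 0 ≤ ∫ ω, (x * f ω - 1 * g ω) ^ 2 ∂m := integral_nonneg fun ω => sq_nonneg _
      linarith
  have hle : ∫ ω, f ω * g ω ∂m ≤ k * a * b := by
    refine abs_le_of_sq_le_sq' ?_ (by positivity) |>.2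
    rw [discrim] at hdiscrim
    linarith
  have h11 := key 1 1
  simp only [one_mul] at h11
  rw [h11]
  linarith

lemma archPath_coupling_cost_ge {s t : ℝ} (hs : s ∈ Icc (0 : ℝ) 1) (ht : t ∈ Icc (0 : ℝ) 1)
    {m : Measure ((ℝ × ℝ) × (ℝ × ℝ))} (h₁ : m.map Prod.fst = archPath s)
    (h₂ : m.map Prod.snd = archPath t) :
    2 / 3 * ((Real.cos (π * s / 2) - Real.cos (π * t / 2)) ^ 2 +
      (Real.sin (π * s / 2) - Real.sin (π * t / 2)) ^ 2) ≤
      ∫ p, ((p.1.1 - p.2.1) ^ 2 + (p.1.2 - p.2.2) ^ 2) ∂m := by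
  have hcos {u : ℝ} (hu : u ∈ Icc (0 : ℝ) 1) : 0 ≤ Real.cos (π * u / 2) :=
    Real.cos_nonneg_of_mem_Icc ⟨by nlinarith [Real.pi_pos, hu.1], by nlinarith [Real.pi_pos, hu.2]⟩
  have hsin {u : ℝ} (hu : u ∈ Icc (0 : ℝ) 1) : 0 ≤ Real.sin (π * u / 2) :=
    Real.sin_nonneg_of_nonneg_of_le_pi (by nlinarith [Real.pi_pos, hu.1])
      (by nlinarith [Real.pi_pos, hu.2])
  have mp₁ : MeasurePreserving Prod.fst m (archPath s) := ⟨measurable_fst, h₁⟩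
  have mp₂ : MeasurePreserving Prod.snd m (archPath t) := ⟨measurable_snd, h₂⟩
  have hP₁ : MemLp (fun p : (ℝ × ℝ) × (ℝ × ℝ) => p.1.1 + p.1.2) 2 m :=
    (memLp_sum_archPath s).comp_measurePreserving mp₁
  have hP₂ : MemLp (fun p : (ℝ × ℝ) × (ℝ × ℝ) => p.2.1 + p.2.2) 2 m :=
    (memLp_sum_archPath t).comp_measurePreserving mp₂
  have hQ₁ : MemLp (fun p : (ℝ × ℝ) × (ℝ × ℝ) => p.1.2 - p.1.1) 2 m :=
    (memLp_diff_archPath s).comp_measurePreserving mp₁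
  have hQ₂ : MemLp (fun p : (ℝ × ℝ) × (ℝ × ℝ) => p.2.2 - p.2.1) 2 m :=
    (memLp_diff_archPath t).comp_measurePreserving mp₂
  have iP₁ := integral_sum_sq_archPath s
  have iP₂ := integral_sum_sq_archPath t
  have iQ₁ := integral_diff_sq_archPath s
  have iQ₂ := integral_diff_sq_archPath t
  rw [← h₁, integral_map measurable_fst.aemeasurable (by fun_prop)] at iP₁ iQ₁
  rw [← h₂, integral_map measurable_snd.aemeasurable (by fun_prop)] at iP₂ iQ₂
  have hP := mul_sq_sub_le_integral_sub_sq hP₁ hP₂ (by norm_num) (hcos hs) (hcos ht) iP₁ iP₂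
  have hQ := mul_sq_sub_le_integral_sub_sq hQ₁ hQ₂ (by norm_num) (hsin hs) (hsin ht) iQ₁ iQ₂
  have hsplit (p : (ℝ × ℝ) × (ℝ × ℝ)) : (p.1.1 - p.2.1) ^ 2 + (p.1.2 - p.2.2) ^ 2 =
      1 / 2 * (((p.1.1 + p.1.2) - (p.2.1 + p.2.2)) ^ 2 +
        ((p.1.2 - p.1.1) - (p.2.2 - p.2.1)) ^ 2) := by ring
  simp only [hsplit]
  rw [integral_const_mul, integral_add (by exact (hP₁.sub hP₂).integrable_sq)
    (by exact (hQ₁.sub hQ₂).integrable_sq)]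
  linarith

lemma integral_archMap_cost (s t : ℝ) :
    ∫ p, (((archMap s p).1 - (archMap t p).1) ^ 2 +
      ((archMap s p).2 - (archMap t p).2) ^ 2) ∂archMeasure =
    2 / 3 * ((Real.cos (π * s / 2) - Real.cos (π * t / 2)) ^ 2 +
      (Real.sin (π * s / 2) - Real.sin (π * t / 2)) ^ 2) := by
  have h (p : ℝ × ℝ) : ((archMap s p).1 - (archMap t p).1) ^ 2 +
      ((archMap s p).2 - (archMap t p).2) ^ 2 =
      2 * (Real.cos (π * s / 2) - Real.cos (π * t / 2)) ^ 2 * p.1 ^ 2 +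
      2 * (Real.sin (π * s / 2) - Real.sin (π * t / 2)) ^ 2 * p.2 ^ 2 := by
    simp only [archMap]
    ring
  simp only [h]
  rw [integral_add (memLp_fst_archMeasure.integrable_sq.const_mul _)
    (memLp_snd_archMeasure.integrable_sq.const_mul _)]
  simp only [integral_const_mul, integral_fst_sq_archMeasure, integral_snd_sq_archMeasure]
  ring

lemma W2sqE_archPath {s t : ℝ} (hs : s ∈ Icc (0 : ℝ) 1) (ht : t ∈ Icc (0 : ℝ) 1) :
    W2sqE (archPath s) (archPath t) =
      2 / 3 * ((Real.cos (π * s / 2) - Real.cos (π * t / 2)) ^ 2 +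
        (Real.sin (π * s / 2) - Real.sin (π * t / 2)) ^ 2) := by
  refine IsLeast.csInf_eq ⟨?_, ?_⟩
  · have hmeas : Measurable fun p => (archMap s p, archMap t p) :=
      (measurable_archMap s).prodMk (measurable_archMap t)
    refine ⟨archMeasure.map fun p => (archMap s p, archMap t p),
      Measure.isProbabilityMeasure_map hmeas.aemeasurable, ?_, ?_, ?_⟩
    · rw [Measure.map_map measurable_fst hmeas]
      exact map_archMap_archMeasure s
    · rw [Measure.map_map measurable_snd hmeas]
      exact map_archMap_archMeasure t
    · rw [integral_map hmeas.aemeasurable (by fun_prop), integral_archMap_cost]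
  · rintro _ ⟨m, -, h₁, h₂, rfl⟩
    exact archPath_coupling_cost_ge hs ht h₁ h₂

/-- the 2-Wasserstein distance along the Archimedean path is
W₂(A(s), A(t)) = √(8/3)·sin(π(t-s)/4) for 0 ≤ s < t ≤ 1. -/
theorem archimedean_path_wasserstein_distance
    (s t : ℝ) (hs : 0 ≤ s) (hst : s < t) (ht : t ≤ 1) :
    Real.sqrt (W2sqE (archPath s) (archPath t)) =
      Real.sqrt (8 / 3) * Real.sin (π * (t - s) / 4) := by
  have hsin : 0 ≤ Real.sin (π * (t - s) / 4) :=
    Real.sin_nonneg_of_nonneg_of_le_pi (by nlinarith [Real.pi_pos]) (by nlinarith [Real.pi_pos])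
  have hcos : Real.cos (π * t / 2 - π * s / 2) = 1 - 2 * Real.sin (π * (t - s) / 4) ^ 2 := by
    rw [show π * t / 2 - π * s / 2 = 2 * (π * (t - s) / 4) by ring, Real.cos_two_mul,
      Real.cos_sq']
    ring
  rw [Real.cos_sub] at hcos
  have hW : W2sqE (archPath s) (archPath t) = 8 / 3 * Real.sin (π * (t - s) / 4) ^ 2 := by
    rw [W2sqE_archPath ⟨hs, by linarith⟩ ⟨by linarith, ht⟩]
    linear_combination 2 / 3 * Real.sin_sq_add_cos_sq (π * s / 2) +
      2 / 3 * Real.sin_sq_add_cos_sq (π * t / 2) - 4 / 3 * hcos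
  rw [hW, Real.sqrt_mul (by norm_num), Real.sqrt_sq hsin]
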